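/- arXiv:1312.1239 — 2 statements merged into one kernel-verified Lean document; each statement's English description precedes it below -/
import Mathlib

section
/- Let A, B, C, D be complex matrices of compatible sizes with A, D square. Set S = A − C D^d B, Z = D − B A^d C, H = B A^d, K = A^d C, and k = ind(A). If C D^d B A^π = 0 and K Z^π D^d H = K Z^d D^π H, then S^d = A^d + K Z^d H + ∑_{i=0}^{k-1} A^i A^π S (A^d + K Z^d H)^{i+2}. -/
open Matrix Finset

attribute [local instance] Classical.propDecidable

noncomputable def drazin {n : Type*} [Fintype n] [DecidableEq n]
    (A : Matrix n n ℂ) : Matrix n n ℂ :=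
  if h : ∃ X : Matrix n n ℂ,
      A * X = X * A ∧ X * A * X = X ∧ ∃ k : ℕ, A ^ (k + 1) * X = A ^ k
  then h.choose else 0

noncomputable def ind {n : Type*} [Fintype n] [DecidableEq n]
    (A : Matrix n n ℂ) : ℕ :=
  sInf {k : ℕ | (A ^ k).rank = (A ^ (k + 1)).rank}

noncomputable def spi {n : Type*} [Fintype n] [DecidableEq n]
    (A : Matrix n n ℂ) : Matrix n n ℂ :=
  1 - A * drazin A

theorem fac_of_rank {n : ℕ} (M M' W : Matrix (Fin n) (Fin n) ℂ) (h : M' = M * W)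
    (hr : M.rank = M'.rank) : ∃ Y, M = M' * Y := by
  have hle : LinearMap.range M'.mulVecLin ≤ LinearMap.range M.mulVecLin := by
    rintro _ ⟨v, rfl⟩
    exact ⟨W *ᵥ v, by simp [h]⟩
  have he : LinearMap.range M'.mulVecLin = LinearMap.range M.mulVecLin :=
    Submodule.eq_of_le_of_finrank_eq hle hr.symm
  have hc : ∀ j, ∃ y : Fin n → ℂ, M' *ᵥ y = M *ᵥ (Pi.single j 1) := by
    intro j
    have : M.mulVecLin (Pi.single j 1) ∈ LinearMap.range M'.mulVecLin := by
      rw [he]; exact ⟨_, rfl⟩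
    obtain ⟨y, hy⟩ := this
    exact ⟨y, hy⟩
  choose y hy using hc
  refine ⟨Matrix.of (fun i j => y j i), ?_⟩
  ext i j
  have := congrFun (hy j) i
  rw [Matrix.mulVec_single_one] at this
  simp only [Matrix.col_apply] at this
  rw [← this]
  rfl

theorem pow_fac {R : Type*} [Ring R] {A Y : R} {k : ℕ} (h : A ^ k = A ^ (k + 1) * Y) (j : ℕ) :
    A ^ k = A ^ (k + j) * Y ^ j := by
  induction j with
  | zero => simp
  | succ j ih =>
    have e : A ^ (k + j) = A ^ (k + (j + 1)) * Y := by
      rw [add_comm k j, pow_add, h, ← mul_assoc, ← pow_add]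
      congr 2; ring
    rw [pow_succ', ← mul_assoc, ← e, ← ih]

theorem pow_fac' {R : Type*} [Ring R] {A Y : R} {k : ℕ} (h : A ^ k = Y * A ^ (k + 1)) (j : ℕ) :
    A ^ k = Y ^ j * A ^ (k + j) := by
  induction j with
  | zero => simp
  | succ j ih =>
    have e : A ^ (k + j) = Y * A ^ (k + (j + 1)) := by
      rw [pow_add, h, mul_assoc, ← pow_add]
      congr 2; ring
    rw [pow_succ, mul_assoc, ← e, ← ih]

theorem drazin_ring {R : Type*} [Ring R] {A Y Y' : R} {k : ℕ} (h : A ^ k = A ^ (k + 1) * Y)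
    (h' : A ^ k = Y' * A ^ (k + 1)) :
    ∃ X : R, A * X = X * A ∧ X * A * X = X ∧ ∃ k : ℕ, A ^ (k + 1) * X = A ^ k := by
  have e1 : ∀ j, A ^ k * Y ^ j = Y' ^ j * A ^ k := by
    intro j
    conv_lhs => rw [pow_fac' h' j]
    conv_rhs => rw [pow_fac h j]
    rw [mul_assoc]
  have c : A * (A ^ k * Y ^ (k + 1)) = (A ^ k * Y ^ (k + 1)) * A := by
    have l : A * (A ^ k * Y ^ (k + 1)) = A ^ k * Y ^ k := by
      rw [pow_succ' Y, ← mul_assoc, ← mul_assoc, ← pow_succ', ← h]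
    have r : (A ^ k * Y ^ (k + 1)) * A = Y' ^ k * A ^ k := by
      rw [e1, pow_succ Y', mul_assoc, mul_assoc, ← pow_succ, ← h']
    rw [l, r, e1]
  have f : A ^ (k + 1) * (A ^ k * Y ^ (k + 1)) = A ^ k := by
    rw [← mul_assoc, ← pow_add, add_comm (k + 1) k, ← pow_fac h]
  refine ⟨A ^ k * Y ^ (k + 1), c, ?_, k, f⟩
  conv_lhs => rw [e1]
  rw [mul_assoc (Y' ^ (k + 1)), ← pow_succ, mul_assoc, ← e1, f, ← e1]

theorem ind_spec {n : ℕ} (A : Matrix (Fin n) (Fin n) ℂ) :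
    (A ^ (ind A)).rank = (A ^ (ind A + 1)).rank := by
  have hne : {k : ℕ | (A ^ k).rank = (A ^ (k + 1)).rank}.Nonempty := by
    by_contra hn
    rw [Set.not_nonempty_iff_eq_empty] at hn
    have hlt : ∀ k, (A ^ (k + 1)).rank < (A ^ k).rank := by
      intro k
      refine lt_of_le_of_ne ?_ ?_
      · rw [pow_succ]; exact Matrix.rank_mul_le_left _ _
      · intro e
        have : k ∈ {k : ℕ | (A ^ k).rank = (A ^ (k + 1)).rank} := e.symm
        rw [hn] at this
        exact this
    have hb : ∀ k, (A ^ k).rank + k ≤ (A ^ 0).rank := by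
      intro k
      induction k with
      | zero => simp
      | succ k ih => have := hlt k; omega
    have := hb ((A ^ 0).rank + 1)
    omega
  exact Nat.sInf_mem hne

theorem fac_right {n : ℕ} (A : Matrix (Fin n) (Fin n) ℂ) :
    ∃ Y, A ^ (ind A) = A ^ (ind A + 1) * Y :=
  fac_of_rank _ _ A (pow_succ _ _) (ind_spec A)

theorem fac_left {n : ℕ} (A : Matrix (Fin n) (Fin n) ℂ) :
    ∃ Y, A ^ (ind A) = Y * A ^ (ind A + 1) := by
  obtain ⟨Y, hY⟩ := fac_of_rank (A ^ (ind A))ᵀ (A ^ (ind A + 1))ᵀ Aᵀ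
    (by rw [pow_succ', Matrix.transpose_mul])
    (by rw [Matrix.rank_transpose, Matrix.rank_transpose, ind_spec])
  refine ⟨Yᵀ, ?_⟩
  have := congrArg Matrix.transpose hY
  simpa only [Matrix.transpose_mul, Matrix.transpose_transpose] using this

theorem drazin_spec {n : ℕ} (A : Matrix (Fin n) (Fin n) ℂ) :
    A * drazin A = drazin A * A ∧ drazin A * A * drazin A = drazin A ∧
      ∃ k : ℕ, A ^ (k + 1) * drazin A = A ^ k := by
  obtain ⟨Y, hY⟩ := fac_right A
  obtain ⟨Y', hY'⟩ := fac_left A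
  have h := drazin_ring hY hY'
  unfold drazin
  rw [dif_pos h]
  exact h.choose_spec

theorem drazin_unique_ring {R : Type*} [Ring R] {A X W : R}
    (hX1 : A * X = X * A) (hX2 : X * A * X = X) (hX3 : ∃ k : ℕ, A ^ (k + 1) * X = A ^ k)
    (hW1 : A * W = W * A) (hW2 : W * A * W = W) (hW3 : ∃ k : ℕ, A ^ (k + 1) * W = A ^ k) :
    X = W := by
  -- `X = X^(j+1) A^j`, `A^k (1 - A W) = 0`
  have key : ∀ X W : R, A * X = X * A → X * A * X = X → A * W = W * A →
      (∃ k : ℕ, A ^ (k + 1) * W = A ^ k) → X = X * A * W := by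
    rintro X W h1 h2 h3 ⟨k, h4⟩
    have hp : ∀ j, X = X ^ (j + 1) * A ^ j := by
      intro j
      induction j with
      | zero => simp
      | succ j ih =>
        calc X = X * A * X := h2.symm
          _ = X * X * A := by rw [mul_assoc, h1, mul_assoc]
          _ = X * (X ^ (j + 1) * A ^ j) * A := by rw [← ih]
          _ = _ := by rw [pow_succ' X (j + 1), pow_succ A j]; simp only [mul_assoc]
    conv_lhs => rw [hp k]
    conv_rhs => rw [hp k]
    rw [mul_assoc, mul_assoc, ← mul_assoc (A ^ k), ← pow_succ, h4]
  have k1 := key X W hX1 hX2 hW1 hW3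
  have k2 := key W X hW1 hW2 hX1 hX3
  have hc : A * X * (A * W) = A * W * (A * X) := by
    have cx : Commute A X := hX1
    have l : A * X * (A * W) = A * X := by
      conv_rhs => rw [k1]
      simp only [mul_assoc]
    have l2 : A * W * (A * X) = A * W := by
      conv_rhs => rw [k2]
      simp only [mul_assoc]
    obtain ⟨k, hk⟩ := hX3
    obtain ⟨l', hl⟩ := hW3
    -- left version: `A W` also absorbs `A X` from the left
    have key' : ∀ X W : R, A * X = X * A → X * A * X = X → A * W = W * A →
      (∃ k : ℕ, A ^ (k + 1) * W = A ^ k) → X = W * A * X := by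
      rintro X W h1 h2 h3 ⟨k, h4⟩
      have hp : ∀ j, X = A ^ j * X ^ (j + 1) := by
        intro j
        induction j with
        | zero => simp
        | succ j ih =>
          calc X = X * A * X := h2.symm
            _ = A * X * X := by rw [h1]
            _ = A * (A ^ j * X ^ (j + 1)) * X := by rw [← ih]
            _ = _ := by rw [pow_succ X (j + 1), pow_succ' A j]; simp only [mul_assoc]
      have h5 : W * A ^ (k + 1) = A ^ k := by
        rw [← h4]; exact ((Commute.pow_left (show Commute A W from h3) (k + 1)).eq).symm
      conv_lhs => rw [hp k]
      conv_rhs => rw [hp k]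
      rw [← mul_assoc, mul_assoc W, ← pow_succ', h5]
    have k3 := key' X W hX1 hX2 hW1 ⟨l', hl⟩
    rw [l]
    conv_lhs => rw [k3]
    simp only [mul_assoc]
  have e : A * X = A * W := by
    have l : A * X * (A * W) = A * X := by
      conv_rhs => rw [k1]
      simp only [mul_assoc]
    have l2 : A * W * (A * X) = A * W := by
      conv_rhs => rw [k2]
      simp only [mul_assoc]
    rw [← l, hc, l2]
  rw [k1, ← hX1, e, hW1, hW2]

theorem ind_pi {n : ℕ} (A : Matrix (Fin n) (Fin n) ℂ) : A ^ (ind A) * spi A = 0 := by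
  obtain ⟨Y, hY⟩ := fac_right A
  obtain ⟨h1, h2, k, h3⟩ := drazin_spec A
  have c : Commute A (spi A) := by
    unfold spi
    exact (Commute.one_right A).sub_right ((Commute.refl A).mul_right h1)
  have z : A ^ k * spi A = 0 := by
    unfold spi
    rw [mul_sub, mul_one, ← mul_assoc, ← pow_succ, h3, sub_self]
  rw [(c.pow_left _).eq, pow_fac hY k, ← mul_assoc, ← (c.pow_left _).eq, pow_add,
    mul_assoc (A ^ ind A), z]
  simp

theorem core {R : Type*} [Ring R] {A q S T : R} {k : ℕ} (hq : q * q = q) (hA : A * q = q * A)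
    (hk : A ^ k * q = 0) (hS : S * q = A * q) (hT : q * T = 0) (hT' : T * q = 0)
    (h1 : T * S = 1 - q) (h2 : (1 - q) * (S * T) = 1 - q) :
    let X := T + ∑ i ∈ range k, A ^ i * q * S * T ^ (i + 2)
    S * X = X * S ∧ X * S * X = X ∧ ∃ k : ℕ, S ^ (k + 1) * X = S ^ k := by
  intro X
  set Rr := ∑ i ∈ range k, A ^ i * q * S * T ^ (i + 1) with hR
  have cA : ∀ i, q * A ^ i = A ^ i * q := fun i =>
    ((Commute.pow_left (show Commute A q from hA) i).eq).symm
  have hTT : T * (1 - q) = T := by rw [mul_sub, hT', mul_one, sub_zero]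
  have hXS : X * S = 1 - q + Rr := by
    simp only [X, add_mul, h1, Finset.sum_mul, hR]
    congr 1
    refine Finset.sum_congr rfl fun i _ => ?_
    rw [pow_succ T (i + 1), mul_assoc _ _ S, mul_assoc _ T S, h1, pow_succ T i, mul_assoc _ T, hTT]
  have hST : S * T = 1 - q + q * S * T := by
    calc S * T = (1 - q) * (S * T) + q * S * T := by noncomm_ring
      _ = _ := by rw [h2]
  have hSX : S * X = 1 - q + Rr := by
    have e : Rr = q * S * T + ∑ i ∈ range k, A ^ (i + 1) * q * S * T ^ (i + 2) := by
      have := Finset.sum_range_succ (fun i => A ^ i * q * S * T ^ (i + 1)) k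
      rw [Finset.sum_range_succ'] at this
      simp only [hk, zero_mul, add_zero, pow_zero, one_mul, zero_add, pow_one] at this
      rw [hR, ← this, add_comm]
    rw [e]
    simp only [X, mul_add, Finset.mul_sum]
    rw [hST, add_assoc]
    congr 2
    refine Finset.sum_congr rfl fun i _ => ?_
    rw [← cA, pow_succ' A, mul_assoc A, ← cA i]
    simp only [← mul_assoc]
    rw [hS]
  have hqR : q * Rr = Rr := by
    rw [hR, Finset.mul_sum]
    refine Finset.sum_congr rfl fun i _ => ?_
    simp only [← mul_assoc]
    rw [cA, mul_assoc (A ^ i), hq]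
  have hXq : X * q = 0 := by
    simp only [X, add_mul, Finset.sum_mul, hT', zero_add]
    refine Finset.sum_eq_zero fun i _ => ?_
    rw [pow_succ T (i + 1), mul_assoc, mul_assoc _ T, hT', mul_zero, mul_zero]
  refine ⟨by rw [hSX, hXS], ?_, k, ?_⟩
  · rw [mul_assoc, hSX, mul_add, mul_sub, hXq, ← hqR, ← mul_assoc, hXq]
    simp
  · have hj : ∀ j, S ^ j * (q - Rr) = A ^ j * (q - Rr) := by
      have hqq : q - Rr = q * (q - Rr) := by rw [mul_sub, hq, hqR]
      intro j
      induction j with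
      | zero => simp
      | succ j ih =>
        rw [pow_succ' S, mul_assoc, ih, hqq, ← mul_assoc (A ^ j), ← cA j, ← mul_assoc, ← mul_assoc,
          hS, mul_assoc A, cA j, ← mul_assoc, ← pow_succ', mul_assoc]
    have hz : S ^ k * (q - Rr) = 0 := by
      rw [hj, ← hqR]
      rw [show q - q * Rr = q * (1 - Rr) by rw [mul_sub, mul_one], ← mul_assoc, hk, zero_mul]
    rw [pow_succ, mul_assoc, hSX, show 1 - q + Rr = 1 - (q - Rr) by abel, mul_sub, hz]
    simp

theorem stmt8 {n m : ℕ} (A : Matrix (Fin n) (Fin n) ℂ) (D : Matrix (Fin m) (Fin m) ℂ)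
    (C : Matrix (Fin n) (Fin m) ℂ) (B : Matrix (Fin m) (Fin n) ℂ)
    (H : Matrix (Fin m) (Fin n) ℂ) (hH : H = B * drazin A)
    (K : Matrix (Fin n) (Fin m) ℂ) (hK : K = drazin A * C)
    (Z : Matrix (Fin m) (Fin m) ℂ) (hZ : Z = D - B * drazin A * C)
    (S : Matrix (Fin n) (Fin n) ℂ) (hS : S = A - C * drazin D * B)
    (h1 : C * drazin D * B * spi A = 0)
    (h2 : K * spi Z * drazin D * H = K * drazin Z * spi D * H) :
    drazin S = drazin A + K * drazin Z * H +
      ∑ i ∈ range (ind A),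
        A ^ i * spi A * S * (drazin A + K * drazin Z * H) ^ (i + 2) := by
  obtain ⟨a1, a2, -⟩ := drazin_spec A
  obtain ⟨z1, -, -⟩ := drazin_spec Z
  have hpi := ind_pi A
  obtain ⟨s1, s2, s3⟩ := drazin_spec S
  set a := drazin A with ha
  set d := drazin D with hd
  set z := drazin Z with hz
  set T := a + K * z * H with hT
  have hq : spi A = 1 - A * a := rfl
  set q := spi A with hqdef
  have qa : q * a = 0 := by
    rw [hq, sub_mul, one_mul, a1, a2, sub_self]
  have aq : a * q = 0 := by
    rw [hq, mul_sub, mul_one, ← mul_assoc, a2, sub_self]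
  have hqq : q * q = q := by
    conv_lhs => lhs; rw [hq]
    rw [sub_mul, one_mul, mul_assoc, aq, mul_zero, sub_zero]
  have hA : A * q = q * A := by
    rw [hq, mul_sub, sub_mul, mul_one, one_mul, mul_assoc A a A, a1]
  have hSq : S * q = A * q := by
    rw [hS, sub_mul, h1, sub_zero]
  have qT : q * T = 0 := by
    rw [hT, hK, mul_add, qa, ← Matrix.mul_assoc, ← Matrix.mul_assoc, ← Matrix.mul_assoc, qa]
    simp
  have Tq : T * q = 0 := by
    rw [hT, hH, add_mul, aq, Matrix.mul_assoc, Matrix.mul_assoc B, aq]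
    simp
  have hCB : C * d * B = C * d * B * (A * a) := by
    have : C * d * B * q = C * d * B - C * d * B * (A * a) := by
      rw [hq, Matrix.mul_sub, Matrix.mul_one]
    rw [h1] at this
    exact (sub_eq_zero.mp this.symm)
  have hTS : T * S = 1 - q := by
    have hHC : H * C = D - Z := by rw [hH, hZ]; abel
    have hHA : H * A = B * (A * a) := by rw [hH, Matrix.mul_assoc, a1]
    have t1 : a * S = A * a - K * d * (H * A) := by
      rw [hS, Matrix.mul_sub, ← a1, hCB, hK, hHA]
      simp only [Matrix.mul_assoc]
    have t2 : K * z * H * S = K * z * (H * A) - K * z * (D - Z) * d * (H * A) := by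
      rw [← hHC, hS, Matrix.mul_sub, hCB, hHA]
      simp only [Matrix.mul_assoc]
      rw [hHA]
    have h2' := congrArg (· * A) h2
    have e1 : spi Z = 1 - z * Z := by rw [← z1]; rfl
    have e2 : spi D = 1 - D * d := rfl
    rw [e1, e2] at h2'
    simp only [Matrix.mul_sub, Matrix.sub_mul, Matrix.mul_one, Matrix.mul_assoc] at h2'
    rw [hT, add_mul, t1, t2, hq]
    simp only [Matrix.mul_sub, Matrix.sub_mul, Matrix.mul_assoc]
    have h3 := sub_eq_zero.mpr h2'
    rw [← sub_eq_zero]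
    rw [← neg_eq_zero, ← h3]
    abel
  have hST : (1 - q) * (S * T) = 1 - q := by
    have hpT : (1 - q) * T = T := by rw [sub_mul, qT, one_mul, sub_zero]
    have u : (T + q) * ((1 - q) * S * (1 - q) + q) = 1 := by
      calc (T + q) * ((1 - q) * S * (1 - q) + q)
          = T * S * (1 - q) - (T * q) * S * (1 - q) + T * q + (q - q * q) * S * (1 - q)
            + q * q := by noncomm_ring
        _ = 1 := by
          rw [Tq, hTS, hqq, mul_sub (1 - q), sub_mul 1 q q, hqq]; simp
    have v := mul_eq_one_comm.mp u
    have w : ((1 - q) * S * (1 - q) + q) * (T + q) = (1 - q) * (S * ((1 - q) * T))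
        + (1 - q) * S * (q - q * q) + q * T + q * q := by noncomm_ring
    rw [w, hpT, hqq, qT] at v
    simp only [sub_self, mul_zero, add_zero] at v
    exact eq_sub_of_add_eq v
  obtain ⟨x1, x2, x3⟩ := core hqq hA hpi hSq qT Tq hTS hST
  exact drazin_unique_ring s1 s2 s3 x1 x2 x3
end

section
/- Let A, B, C, D be complex matrices of compatible sizes with A, D square. Set S = A − C D^d B, Z = D − B A^d C, k = ind(A), s = ind(Z). If A^π C D^d B = 0, D^π B A^d C = 0, and D^d B A A^d = D^d D B A^d, then S^d = S_A^d + ∑_{i=0}^{k-1} (S_A^d)^{i+2} S A^i A^π, where S_A^d = A^d + A^d C Z^d D^d B A A^d − ∑_{i=0}^{s-1} (A^d)^{i+2} C D D^d Z^i Z^π D^d B A A^d. -/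
open Matrix Finset

attribute [local instance] Classical.propDecidable

theorem aux_exists {n : Type*} [Fintype n] [DecidableEq n] (A : Matrix n n ℂ) :
    ∃ X : Matrix n n ℂ,
      A * X = X * A ∧ X * A * X = X ∧ ∃ k : ℕ, A ^ (k + 1) * X = A ^ k := by
  have hp : A.charpoly ≠ 0 := (Matrix.charpoly_monic A).ne_zero
  obtain ⟨q, hq, hnd⟩ := Polynomial.exists_eq_pow_rootMultiplicity_mul_and_not_dvd
    A.charpoly hp 0
  set k := A.charpoly.rootMultiplicity 0
  rw [Polynomial.C_0, sub_zero] at hq hnd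
  have hcop : IsCoprime (Polynomial.X : Polynomial ℂ) q :=
    (Polynomial.irreducible_X.coprime_iff_not_dvd).2 hnd
  obtain ⟨u, v, huv⟩ := hcop
  have hA : A ^ k * Polynomial.aeval A q = 0 := by
    have := Matrix.aeval_self_charpoly A
    rw [hq] at this
    simpa using this
  have h1 : Polynomial.aeval A u * A + Polynomial.aeval A v * Polynomial.aeval A q = 1 := by
    have := congrArg (Polynomial.aeval A) huv
    simpa using this
  set w := Polynomial.aeval A u
  have hc : Commute w A := by
    have : Commute (Polynomial.aeval A u) (Polynomial.aeval A (Polynomial.X : Polynomial ℂ)) := by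
      unfold Commute SemiconjBy
      rw [← map_mul, ← map_mul, mul_comm]
    simpa using this
  have hvq : Polynomial.aeval A v * Polynomial.aeval A q =
      Polynomial.aeval A q * Polynomial.aeval A v := by
    rw [← map_mul, ← map_mul, mul_comm]
  have hw : A ^ (k + 1) * w = A ^ k := by
    have := congrArg (fun M => A ^ k * M) h1
    simp only [mul_add, mul_one] at this
    rw [hvq, ← mul_assoc (A ^ k) (Polynomial.aeval A q), hA, zero_mul, add_zero, hc.eq,
      ← mul_assoc, ← pow_succ] at this
    exact this
  have hwj : ∀ j, A ^ (k + j) * w ^ j = A ^ k := by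
    intro j
    induction j with
    | zero => simp
    | succ j ih =>
      have : A ^ (k + (j + 1)) * w ^ (j + 1) = A ^ j * (A ^ (k + 1) * w) * w ^ j := by
        rw [pow_succ' w]
        simp only [← mul_assoc, ← pow_add]
        congr 3
        omega
      rw [this, hw, ← pow_add, add_comm j k, ih]
  have hcX : Commute A (A ^ k * w ^ (k + 1)) :=
    ((Commute.refl A).pow_right k).mul_right (hc.symm.pow_right _)
  have hwX : Commute w (A ^ k * w ^ (k + 1)) :=
    (hc.pow_right k).mul_right ((Commute.refl w).pow_right _)
  have hkX : A ^ (k + 1) * (A ^ k * w ^ (k + 1)) = A ^ k := by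
    rw [← mul_assoc, ← pow_add, show k + 1 + k = k + (k + 1) by omega, hwj]
  refine ⟨A ^ k * w ^ (k + 1), hcX.eq, ?_, k, hkX⟩
  rw [← hcX.eq]
  have e1 : A * (A ^ k * w ^ (k + 1)) = w ^ (k + 1) * A ^ (k + 1) := by
    rw [← mul_assoc, ← pow_succ', (hc.pow_pow (k + 1) (k + 1)).eq]
  rw [e1, mul_assoc, hkX, (hc.pow_pow (k + 1) k).eq]

theorem aux_spec {n : Type*} [Fintype n] [DecidableEq n] (A : Matrix n n ℂ) :
    A * drazin A = drazin A * A ∧ drazin A * A * drazin A = drazin A ∧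
      ∃ k : ℕ, A ^ (k + 1) * drazin A = A ^ k := by
  have h := aux_exists A
  unfold drazin
  rw [dif_pos h]
  exact h.choose_spec

theorem aux_comm {n : Type*} [Fintype n] [DecidableEq n] (A : Matrix n n ℂ) :
    Commute A (spi A) := by
  have h := (aux_spec A).1
  unfold Commute SemiconjBy spi
  rw [mul_sub, sub_mul, mul_one, one_mul, mul_assoc A, ← h]

theorem aux_nil {n : Type*} [Fintype n] [DecidableEq n] (A : Matrix n n ℂ) :
    ∃ k : ℕ, A ^ k * spi A = 0 := by
  obtain ⟨k, hk⟩ := (aux_spec A).2.2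
  refine ⟨k, ?_⟩
  rw [spi, mul_sub, mul_one, ← mul_assoc, ← pow_succ, hk, sub_self]

theorem aux_ind {n : Type*} [Fintype n] [DecidableEq n] (A : Matrix n n ℂ) :
    A ^ (ind A) * spi A = 0 := by
  have hne : {k : ℕ | (A ^ k).rank = (A ^ (k + 1)).rank}.Nonempty := by
    obtain ⟨k, hk⟩ := (aux_spec A).2.2
    refine ⟨k, le_antisymm ?_ ?_⟩
    · conv_lhs => rw [← hk]
      exact Matrix.rank_mul_le_left _ _
    · rw [pow_succ]
      exact Matrix.rank_mul_le_left _ _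
  have hr : (A ^ (ind A)).rank = (A ^ (ind A + 1)).rank := Nat.sInf_mem hne
  set k := ind A
  have hle : LinearMap.range (A ^ (k + 1)).mulVecLin ≤ LinearMap.range (A ^ k).mulVecLin := by
    rw [pow_succ, Matrix.mulVecLin_mul]
    exact LinearMap.range_comp_le_range _ _
  have heq := Submodule.eq_of_le_of_finrank_eq hle hr.symm
  have hY : ∃ Y : Matrix n n ℂ, A ^ (k + 1) * Y = A ^ k := by
    have : ∀ j, ∃ y : n → ℂ, (A ^ (k + 1)) *ᵥ y = (A ^ k) *ᵥ (Pi.single j 1) := by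
      intro j
      have hm : (A ^ k).mulVecLin (Pi.single j 1) ∈ LinearMap.range (A ^ k).mulVecLin :=
        ⟨_, rfl⟩
      rw [← heq] at hm
      obtain ⟨y, hy⟩ := hm
      exact ⟨y, by simpa using hy⟩
    choose y hy using this
    refine ⟨Matrix.of (fun i j => y j i), ?_⟩
    ext i j
    have := congrFun (hy j) i
    rw [Matrix.mulVec_single_one] at this
    exact this
  obtain ⟨Y, hY⟩ := hY
  have hYj : ∀ j, ∃ W : Matrix n n ℂ, A ^ (k + j) * W = A ^ k := by
    intro j
    induction j with
    | zero => exact ⟨1, by simp⟩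
    | succ j ih =>
      obtain ⟨W, hW⟩ := ih
      refine ⟨Y * W, ?_⟩
      rw [← mul_assoc, show k + (j + 1) = j + (k + 1) by omega, pow_add, mul_assoc (A ^ j), hY,
        ← pow_add, add_comm j k, hW]
  obtain ⟨l, hl⟩ := aux_nil A
  obtain ⟨W, hW⟩ := hYj l
  rw [((aux_comm A).pow_left k).eq, ← hW, ← mul_assoc, add_comm, pow_add, ← mul_assoc,
    ← ((aux_comm A).pow_left l).eq, hl, zero_mul, zero_mul]

theorem aux_pow {n m : Type*} [Fintype n] [DecidableEq n] [Fintype m] [DecidableEq m]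
    (Z : Matrix m m ℂ) (T : Matrix n n ℂ) (U : Matrix m n ℂ) (h : Z * U = U * T) (j : ℕ) :
    Z ^ j * U = U * T ^ j := by
  induction j with
  | zero => simp
  | succ j ih => rw [pow_succ, Matrix.mul_assoc, h, ← Matrix.mul_assoc, ih, Matrix.mul_assoc,
      ← pow_succ]

theorem aux_d1 {n : Type*} [Fintype n] [DecidableEq n] (T : Matrix n n ℂ) (j : ℕ) :
    drazin T = T ^ j * drazin T ^ (j + 1) := by
  obtain ⟨hc, hi, -⟩ := aux_spec T
  induction j with
  | zero => simp
  | succ j ih =>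
    rw [pow_succ T, pow_succ' _ (j + 1), pow_succ' _ j, mul_assoc, ← mul_assoc T, ← mul_assoc (T * drazin T),
      hc, hi, ← pow_succ', ← ih]

theorem aux_d2 {n : Type*} [Fintype n] [DecidableEq n] (T : Matrix n n ℂ) (j : ℕ) :
    drazin T = drazin T ^ (j + 1) * T ^ j := by
  have hc : Commute T (drazin T) := (aux_spec T).1
  rw [← (hc.pow_pow j (j + 1)).eq, ← aux_d1]

theorem aux_inter {n m : Type*} [Fintype n] [DecidableEq n] [Fintype m] [DecidableEq m]
    (Z : Matrix m m ℂ) (T : Matrix n n ℂ) (U : Matrix m n ℂ) (h : Z * U = U * T) :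
    drazin Z * U = U * drazin T := by
  have hp := aux_pow Z T U h
  have e1 : spi Z * (U * drazin T) = 0 := by
    obtain ⟨j, hj⟩ := aux_nil Z
    rw [((aux_comm Z).pow_left j).eq] at hj
    rw [aux_d1 T j, ← Matrix.mul_assoc U, ← hp, ← Matrix.mul_assoc, ← Matrix.mul_assoc, hj,
      Matrix.zero_mul, Matrix.zero_mul]
  have e2 : (drazin Z * U) * spi T = 0 := by
    obtain ⟨j, hj⟩ := aux_nil T
    rw [aux_d2 Z j, Matrix.mul_assoc _ _ U, hp, Matrix.mul_assoc, Matrix.mul_assoc, hj,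
      Matrix.mul_zero, Matrix.mul_zero]
  rw [spi, Matrix.sub_mul, Matrix.one_mul, sub_eq_zero] at e1
  rw [spi, Matrix.mul_sub, Matrix.mul_one, sub_eq_zero] at e2
  rw [e1, e2, (aux_spec Z).1]
  simp only [Matrix.mul_assoc]
  rw [← Matrix.mul_assoc Z U, h, Matrix.mul_assoc]

theorem aux_spi {n m : Type*} [Fintype n] [DecidableEq n] [Fintype m] [DecidableEq m]
    (Z : Matrix m m ℂ) (T : Matrix n n ℂ) (U : Matrix m n ℂ) (h : Z * U = U * T) :
    spi Z * U = U * spi T := by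
  rw [spi, spi, Matrix.sub_mul, Matrix.mul_sub, Matrix.one_mul, Matrix.mul_one, Matrix.mul_assoc,
    aux_inter Z T U h, ← Matrix.mul_assoc, h, Matrix.mul_assoc]

/-- Block triangular Drazin inverse. -/
theorem aux_block {n : Type*} [Fintype n] [DecidableEq n] (A S : Matrix n n ℂ)
    (h : spi A * S = A * spi A) :
    drazin S = drazin (S * (A * drazin A)) + ∑ i ∈ range (ind A),
      drazin (S * (A * drazin A)) ^ (i + 2) * S * A ^ i * spi A := by
  obtain ⟨hc, hi, -⟩ := aux_spec A
  set e := A * drazin A with he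
  have hee : e * e = e := by
    rw [he, mul_assoc, ← mul_assoc (drazin A), hi]
  have hp : spi A = 1 - e := rfl
  have hpA : Commute A (spi A) := aux_comm A
  have hpp : spi A * spi A = spi A := by
    rw [hp, sub_mul, one_mul, mul_sub e, hee]; simp
  have hAp : drazin A * spi A = 0 := by
    rw [hp, mul_sub, mul_one, he, ← mul_assoc, hi, sub_self]
  set G := drazin (S * e) with hG
  have hpe : spi A * e = 0 := by rw [hp, sub_mul, hee, one_mul, sub_self]
  have heT : e * (S * e) = S * e := by
    have : spi A * (S * e) = 0 := by
      rw [← mul_assoc, h, mul_assoc, hpe, mul_zero]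
    rw [hp, sub_mul, one_mul, sub_eq_zero] at this
    exact this.symm
  have heG : e * G = G := by
    rw [hG, aux_d1 (S * e) 1, pow_one, ← mul_assoc, heT]
  have hGe : G * e = G := by
    rw [hG, aux_d2 (S * e) 1, pow_one, mul_assoc, mul_assoc, hee]
  have hSe : drazin S * e = G := by
    rw [aux_inter S (S * e) e heT.symm, heG]
  have hSej : ∀ j, drazin S ^ (j + 1) * e = G ^ (j + 1) := by
    intro j
    induction j with
    | zero => simpa using hSe
    | succ j ih =>
      rw [pow_succ, mul_assoc, hSe, ← heG, ← mul_assoc, ih, heG, ← pow_succ]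
  have hstep : ∀ j, drazin S ^ (j + 1) * spi A =
      G ^ (j + 2) * S * spi A + drazin S ^ (j + 2) * spi A * A := by
    intro j
    have e1 : drazin S ^ (j + 1) = drazin S ^ (j + 2) * S := by
      have e0 : drazin S = drazin S ^ 2 * S := by simpa using aux_d2 S 1
      rw [pow_add _ j 2, mul_assoc, ← e0, pow_succ]
    have e2 : (1 : Matrix n n ℂ) = e + spi A := by rw [hp]; abel
    calc drazin S ^ (j + 1) * spi A = drazin S ^ (j + 2) * (e + spi A) * S * spi A := by
          rw [← e2, mul_one, ← e1]
      _ = drazin S ^ (j + 1 + 1) * e * S * spi A + drazin S ^ (j + 2) * (spi A * S) * spi A := by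
          noncomm_ring
      _ = _ := by
          rw [hSej, h, hpA.eq, mul_assoc (drazin S ^ (j + 2)), mul_assoc (spi A), hpA.eq,
            ← mul_assoc (spi A), hpp, ← mul_assoc]
  have hit : ∀ k, drazin S * spi A =
      ∑ i ∈ range k, G ^ (i + 2) * S * A ^ i * spi A + drazin S ^ (k + 1) * spi A * A ^ k := by
    intro k
    induction k with
    | zero => simp
    | succ k ih =>
      rw [ih, sum_range_succ, hstep, add_mul, add_assoc]
      congr 2
      · rw [mul_assoc, ← (hpA.pow_left k).eq, ← mul_assoc]
      · rw [mul_assoc _ A, ← pow_succ']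
  have hlast := hit (ind A)
  rw [mul_assoc (drazin S ^ (ind A + 1)), ← (hpA.pow_left _).eq, aux_ind, mul_zero, add_zero] at hlast
  rw [← hlast, ← hSe, ← mul_add, hp]
  simp

theorem stmt16 {n m : ℕ} (A : Matrix (Fin n) (Fin n) ℂ) (D : Matrix (Fin m) (Fin m) ℂ)
    (C : Matrix (Fin n) (Fin m) ℂ) (B : Matrix (Fin m) (Fin n) ℂ)
    (S : Matrix (Fin n) (Fin n) ℂ) (hS : S = A - C * drazin D * B)
    (Z : Matrix (Fin m) (Fin m) ℂ) (hZ : Z = D - B * drazin A * C)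
    (SAd : Matrix (Fin n) (Fin n) ℂ)
    (hSAd : SAd = drazin A + drazin A * C * drazin Z * drazin D * B * (A * drazin A) -
      ∑ i ∈ range (ind Z),
        (drazin A) ^ (i + 2) * C * (D * drazin D) * Z ^ i * spi Z *
          drazin D * B * (A * drazin A))
    (h1 : spi A * (C * drazin D * B) = 0)
    (h2 : spi D * (B * drazin A * C) = 0)
    (h3 : drazin D * B * (A * drazin A) = drazin D * D * B * drazin A) :
    drazin S = SAd + ∑ i ∈ range (ind A), SAd ^ (i + 2) * S * A ^ i * spi A := by
  obtain ⟨hc, hi, -⟩ := aux_spec A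
  obtain ⟨hcD, hiD, -⟩ := aux_spec D
  have hpS : spi A * S = A * spi A := by
    rw [hS, mul_sub, h1, sub_zero, (aux_comm A).eq]
  have key := aux_block A S hpS
  suffices hT : SAd = drazin (S * (A * drazin A)) by
    rw [key, ← hT]
  set a := drazin A with ha
  set d := drazin D with hd
  set e := A * a with he
  have hee : e * e = e := by
    rw [he, mul_assoc, ← mul_assoc a, hi]
  have hae : a * e = a := by rw [he, ← mul_assoc, hi]
  have hea : e * a = a := by rw [hc, hi]
  have haA : a * A = e := hc.symm
  have hAe : A * e = e * A := by rw [he, mul_assoc A a A, haA]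
  set T := S * e with hTdef
  set U := d * B * e with hU
  have hCU : C * U = A * e - T := by
    rw [hTdef, hS, Matrix.sub_mul, hU]
    simp only [Matrix.mul_assoc]
    abel
  have hfU : D * d * U = U := by
    rw [hU, hcD]
    simp only [← Matrix.mul_assoc]
    rw [hiD]
  have hDU : D * U = U * A := by
    have : U * A = d * D * B * e := by
      rw [h3, Matrix.mul_assoc, haA]
    rw [this, hU, ← hcD]
    simp only [Matrix.mul_assoc]
  have hUe : U * e = U := by rw [hU, Matrix.mul_assoc, hee]
  have hBaC : B * a * C = U * C := by
    rw [spi, Matrix.sub_mul, Matrix.one_mul, sub_eq_zero] at h2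
    rw [h2, h3, ← hd, hcD]
    simp only [Matrix.mul_assoc]
  have hZU : Z * U = U * T := by
    have hT2 : T = A * e - C * U := by rw [hCU]; abel
    rw [hZ, hBaC, Matrix.sub_mul, hDU, hT2, Matrix.mul_sub, hAe, ← Matrix.mul_assoc U e, hUe,
      Matrix.mul_assoc U C U]
  have heT : e * T = T := by
    have hpe : spi A * e = 0 := by
      rw [spi, ← ha, ← he, sub_mul, hee, one_mul, sub_self]
    have : spi A * T = 0 := by
      rw [hTdef, ← mul_assoc, hpS, mul_assoc, hpe, mul_zero]
    rw [spi, ← ha, ← he, sub_mul, one_mul, sub_eq_zero] at this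
    exact this.symm
  have heG : e * drazin T = drazin T := by
    rw [aux_d1 T 1, pow_one, ← mul_assoc, heT]
  have haCU : a * (C * U) = e - a * T := by
    rw [hCU, mul_sub, ← mul_assoc, haA, hee]
  have ht : ∀ i, a ^ (i + 2) * C * (D * d) * Z ^ i * spi Z * d * B * e =
      a ^ (i + 1) * T ^ i * spi T - a ^ (i + 1 + 1) * T ^ (i + 1) * spi T := by
    intro i
    have e1 : a ^ (i + 2) * C * (D * d) * Z ^ i * spi Z * d * B * e =
        a ^ (i + 2) * (C * ((D * d) * (Z ^ i * (spi Z * U)))) := by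
      rw [hU]; simp only [Matrix.mul_assoc]
    have e2 : (D * d) * (Z ^ i * (spi Z * U)) = U * (T ^ i * spi T) := by
      rw [aux_spi Z T U hZU, ← Matrix.mul_assoc (Z ^ i), aux_pow Z T U hZU, Matrix.mul_assoc U,
        ← Matrix.mul_assoc _ U, hfU]
    have e3 : a ^ (i + 1) * e = a ^ (i + 1) := by rw [pow_succ, mul_assoc, hae]
    rw [e1, e2, ← Matrix.mul_assoc C, pow_succ a (i + 1), mul_assoc, ← mul_assoc a, haCU, sub_mul,
      mul_sub, ← mul_assoc _ e, e3, pow_succ' T i]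
    simp only [mul_assoc]
  have hsum : ∀ s, ∑ i ∈ range s, (a ^ (i + 1) * T ^ i * spi T -
      a ^ (i + 1 + 1) * T ^ (i + 1) * spi T) = a * spi T - a ^ (s + 1) * T ^ s * spi T := by
    intro s
    rw [Finset.sum_range_sub' (fun i => a ^ (i + 1) * T ^ i * spi T)]
    simp
  have hN : e * (T ^ ind Z * spi T) = a * (T * (T ^ ind Z * spi T)) := by
    have e1 : U * (T ^ ind Z * spi T) = 0 := by
      rw [← Matrix.mul_assoc, ← aux_pow Z T U hZU, Matrix.mul_assoc, ← aux_spi Z T U hZU,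
        ← Matrix.mul_assoc, aux_ind, Matrix.zero_mul]
    have e2 : (e - a * T) * (T ^ ind Z * spi T) = 0 := by
      rw [← haCU, Matrix.mul_assoc, Matrix.mul_assoc, e1, Matrix.mul_zero, Matrix.mul_zero]
    rw [sub_mul, sub_eq_zero, mul_assoc a] at e2
    exact e2
  set N := T ^ ind Z * spi T with hNdef
  have hTN : Commute T N := ((Commute.refl T).pow_right _).mul_right (aux_comm T)
  have haN : a * N = a ^ 2 * N * T := by
    rw [← hae, mul_assoc, hN, hae, hTN.eq, sq]
    simp only [mul_assoc]
  have hj : ∀ j, a * N = a ^ (j + 1) * N * T ^ j := by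
    intro j
    induction j with
    | zero => simp
    | succ j ih =>
      rw [ih, pow_succ a j, mul_assoc (a ^ j), haN, pow_succ' T j, pow_add a j 2]
      simp only [mul_assoc]
  have hzero : a * N = 0 := by
    obtain ⟨j, hj0⟩ := aux_nil T
    rw [hj j, mul_assoc, ← (hTN.pow_left j).eq, hNdef, ← mul_assoc (T ^ j), ← pow_add, add_comm j (ind Z),
      pow_add T, mul_assoc (T ^ ind Z), hj0, mul_zero, mul_zero]
  have hm : a * C * drazin Z * d * B * e = drazin T - a * T * drazin T := by
    have : a * C * drazin Z * d * B * e = a * (C * (drazin Z * U)) := by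
      rw [hU]; simp only [Matrix.mul_assoc]
    rw [this, aux_inter Z T U hZU, ← Matrix.mul_assoc C, ← mul_assoc, haCU, sub_mul, heG]
  rw [hSAd, hm, Finset.sum_congr rfl (fun i _ => ht i), hsum, mul_assoc (a ^ (ind Z + 1)), ← hNdef,
    pow_succ a, mul_assoc (a ^ ind Z), hzero, mul_zero, spi, mul_sub, mul_one, mul_assoc]
  abel
end
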